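/- arXiv:0912.3028 — 3 statements merged into one kernel-verified Lean document; each statement's English description precedes it below -/
import Mathlib

section
/- Let (B_t)_{t≥0} be a standard Brownian motion on a probability space (Ω, 𝒜, P). Then for every a > 0, every β ∈ ℝ and every s > 0, the probability that the path u ↦ a + β·u + B_u stays strictly positive on the whole interval [0, s] is given by P(∀ u ∈ [0, s], a + β·u + B_u > 0) = Φ((a + β·s)/√s) − exp(−2·β·a)·Φ((−a + β·s)/√s). (This is the analytic core of the survival probability formula (survcoher) of the Analytically-Tractable First Passage (AT1P) model: with a = log(V₀/H) and s = ∫₀ᵀ σ_u² du it yields Q(τ > T) = Φ((log(V₀/H) + β∫₀ᵀσ²)/√(∫₀ᵀσ²)) − (H/V₀)^{2β}·Φ((log(H/V₀) + β∫₀ᵀσ²)/√(∫₀ᵀσ²)).) -/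
open MeasureTheory ProbabilityTheory

/-- The standard normal cumulative distribution function
`Φ(x) = ∫_{-∞}^x (1/√(2π))·exp(-u²/2) du`. -/
noncomputable def stdNormalCDF (x : ℝ) : ℝ :=
  (ProbabilityTheory.gaussianReal 0 1 (Set.Iic x)).toReal


lemma aux_indep {Ω : Type*} {m m0 : MeasurableSpace Ω} (hm : m ≤ m0) (P : Measure[m0] Ω)
    [IsProbabilityMeasure P] (X Z : Ω → ℝ) (hX : Measurable[m] X) (hZ : Measurable Z)
    (hind : Indep (MeasurableSpace.comap Z (borel ℝ)) m P) (G : Set Ω) (hG : MeasurableSet[m] G)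
    (f : ℝ → ℝ) (hf : Measurable f) (c : ℝ)
    (hint : Integrable (fun ω => f (X ω + Z ω)) P)
    (hc : ∀ ω ∈ G, |∫ z, f (X ω + z) ∂(P.map Z)| ≤ c) :
    |∫ ω in G, f (X ω + Z ω) ∂P| ≤ c * P.real G := by
  have hX' : Measurable X := hX.mono hm le_rfl
  have hmap : (P.restrict G).map (fun ω => (X ω, Z ω)) = ((P.restrict G).map X).prod (P.map Z) := by
    symm
    have : IsProbabilityMeasure (P.map Z) := Measure.isProbabilityMeasure_map hZ.aemeasurable
    refine Measure.prod_eq (fun s t hs ht => ?_)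
    rw [Measure.map_apply (hX'.prodMk hZ) (hs.prod ht), Measure.map_apply hX' hs,
      Measure.map_apply hZ ht, Measure.restrict_apply (hX'.prodMk hZ (hs.prod ht)),
      Measure.restrict_apply (hX' hs)]
    have h1 := (Indep_iff _ _ _).1 hind (Z ⁻¹' t) (X ⁻¹' s ∩ G) ⟨t, ht, rfl⟩ ((hX hs).inter hG)
    rw [mul_comm, ← h1]
    congr 1
    ext ω
    simp only [Set.mem_inter_iff, Set.mem_preimage, Set.mem_prod]
    tauto
  have hF : Measurable (fun p : ℝ × ℝ => f (p.1 + p.2)) := hf.comp (by fun_prop)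
  have h2 : ∫ ω in G, f (X ω + Z ω) ∂P = ∫ ω in G, (∫ z, f (X ω + z) ∂(P.map Z)) ∂P := by
    have : IsProbabilityMeasure (P.map Z) := Measure.isProbabilityMeasure_map hZ.aemeasurable
    have e1 : ∫ ω in G, f (X ω + Z ω) ∂P
        = ∫ p, f (p.1 + p.2) ∂((P.restrict G).map (fun ω => (X ω, Z ω))) := by
      rw [integral_map (hX'.prodMk hZ).aemeasurable hF.aestronglyMeasurable]
    rw [e1, hmap, integral_prod, integral_map hX'.aemeasurable]
    · exact (hF.stronglyMeasurable.integral_prod_right).aestronglyMeasurable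
    · rw [← hmap, integrable_map_measure hF.aestronglyMeasurable (hX'.prodMk hZ).aemeasurable]
      exact hint.integrableOn
  rw [h2]
  exact norm_setIntegral_le_of_norm_le_const (f := fun ω => ∫ z, f (X ω + z) ∂(P.map Z))
    (measure_lt_top _ _) hc

lemma aux_grid (h : ℝ → ℝ) (T : ℝ) (hT : 0 < T) (hh : ContinuousOn h (Set.Icc 0 T))
    (u : ℝ) (hu : u ∈ Set.Icc 0 T) (hneg : h u < 0) :
    ∀ᶠ n : ℕ in Filter.atTop, ∃ k ∈ Finset.range (n + 2), h (k * T / (n + 1)) < 0 := by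
  obtain ⟨ε, hε, H⟩ := Metric.continuousOn_iff.1 hh u hu (-h u) (by linarith)
  have hl : Filter.Tendsto (fun n : ℕ => T * (1 / ((n:ℝ) + 1))) Filter.atTop (nhds (T * 0)) :=
    tendsto_one_div_add_atTop_nhds_zero_nat.const_mul T
  rw [mul_zero] at hl
  filter_upwards [hl.eventually (gt_mem_nhds hε)] with n hn
  have hn0 : (0:ℝ) < n + 1 := by positivity
  obtain ⟨hu0, hu1⟩ := hu
  have hx0 : 0 ≤ u * (n + 1) / T := by positivity
  have ha := Nat.floor_le hx0
  have hb := Nat.lt_floor_add_one (u * (n + 1) / T)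
  set k := ⌊u * (n + 1) / T⌋₊
  rw [le_div_iff₀ hT] at ha
  rw [div_lt_iff₀ hT] at hb
  have c1 : k * T / (n + 1) ≤ u := by rw [div_le_iff₀ hn0]; exact ha
  have c2 : u < k * T / (n + 1) + T * (1 / (n + 1)) := by
    have : k * T / (n + 1) + T * (1 / (n + 1)) = (k + 1) * T / ((n:ℝ) + 1) := by ring
    rw [this, lt_div_iff₀ hn0]; exact hb
  refine ⟨k, ?_, ?_⟩
  · rw [Finset.mem_range]
    have : (k:ℝ) * T ≤ (n + 1) * T := by nlinarith
    have := le_of_mul_le_mul_right this hT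
    have : k ≤ n + 1 := by exact_mod_cast this
    omega
  · have := H (k * T / (n + 1)) ⟨by positivity, by linarith⟩ (by
      rw [Real.dist_eq, abs_lt]; constructor <;> linarith)
    rw [Real.dist_eq, abs_lt] at this
    linarith

/-- uniform continuity along the grid -/
lemma aux_unif (h : ℝ → ℝ) (T : ℝ) (hT : 0 < T) (hh : ContinuousOn h (Set.Icc 0 T))
    (δ : ℝ) (hδ : 0 < δ) :
    ∀ᶠ n : ℕ in Filter.atTop, ∀ k ∈ Finset.range (n + 1),
      |h ((k + 1 : ℕ) * T / (n + 1)) - h (k * T / (n + 1))| ≤ δ := by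
  obtain ⟨ε, hε, H⟩ := Metric.uniformContinuousOn_iff.1
    (isCompact_Icc.uniformContinuousOn_of_continuous hh) δ hδ
  have hl : Filter.Tendsto (fun n : ℕ => T * (1 / ((n:ℝ) + 1))) Filter.atTop (nhds (T * 0)) :=
    tendsto_one_div_add_atTop_nhds_zero_nat.const_mul T
  rw [mul_zero] at hl
  filter_upwards [hl.eventually (gt_mem_nhds hε)] with n hn k hk
  have hn0 : (0:ℝ) < n + 1 := by positivity
  have hk' : (k:ℝ) + 1 ≤ n + 1 := by
    have := Finset.mem_range.1 hk
    exact_mod_cast this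
  have := H ((k + 1 : ℕ) * T / (n + 1)) ⟨by positivity, by
      rw [div_le_iff₀ hn0]; push_cast; nlinarith⟩ (k * T / (n + 1)) ⟨by positivity, by
      rw [div_le_iff₀ hn0]; nlinarith⟩ (by
      have e : ((k + 1 : ℕ):ℝ) * T / (n + 1) - k * T / (n + 1) = T * (1 / (n + 1)) := by
        push_cast; ring
      rw [Real.dist_eq, e, abs_of_pos (by positivity)]; exact hn)
  exact this.le


lemma cdf_lip_aux (x y : ℝ) (h : x ≤ y) :
    stdNormalCDF x ≤ stdNormalCDF y ∧ stdNormalCDF y - stdNormalCDF x ≤ y - x := by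
  have e : stdNormalCDF y = stdNormalCDF x + (gaussianReal 0 1).real (Set.Ioc x y) := by
    unfold stdNormalCDF
    rw [← Set.Iic_union_Ioc_eq_Iic h]
    exact measureReal_union (by
      rw [Set.disjoint_left]; intro z hz hz'; exact absurd hz'.1 (not_lt.2 hz)) measurableSet_Ioc
  have hb : (gaussianReal 0 1).real (Set.Ioc x y) ≤ y - x := by
    unfold Measure.real
    refine ENNReal.toReal_le_of_le_ofReal (by linarith) ?_
    rw [gaussianReal_apply _ one_ne_zero]
    calc ∫⁻ z in Set.Ioc x y, gaussianPDF 0 1 z ≤ ∫⁻ z in Set.Ioc x y, 1 := by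
          refine lintegral_mono (fun z => ?_)
          rw [gaussianPDF, ENNReal.ofReal_le_one, gaussianPDFReal]
          have h1 : (√(2 * Real.pi * (1:NNReal)))⁻¹ ≤ 1 := by
            refine inv_le_one_of_one_le₀ (Real.one_le_sqrt.2 ?_)
            have := Real.pi_gt_three
            push_cast
            linarith
          have h2 : Real.exp (-(z - 0) ^ 2 / (2 * (1:NNReal))) ≤ 1 := by
            rw [Real.exp_le_one_iff]
            push_cast
            nlinarith [sq_nonneg (z-0)]
          exact mul_le_one₀ h1 (Real.exp_nonneg _) h2
      _ = ENNReal.ofReal (y - x) := by simp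
  have : 0 ≤ (gaussianReal 0 1).real (Set.Ioc x y) := measureReal_nonneg
  constructor <;> linarith

lemma cdf_lip (x y : ℝ) : |stdNormalCDF y - stdNormalCDF x| ≤ |y - x| := by
  rcases le_total x y with h | h
  · have := cdf_lip_aux x y h
    rw [abs_of_nonneg (by linarith), abs_of_nonneg (by linarith)]; exact this.2
  · have := cdf_lip_aux y x h
    rw [abs_sub_comm, abs_sub_comm y x, abs_of_nonneg (by linarith), abs_of_nonneg (by linarith)]; exact this.2

lemma cdf_cont : Continuous stdNormalCDF :=
  (LipschitzWith.of_dist_le_mul (K := 1) (fun x y => by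
    simpa [Real.dist_eq] using cdf_lip y x)).continuous

lemma cdf_scale (t : ℝ) (ht : 0 < t) (x : ℝ) :
    (gaussianReal 0 t.toNNReal).real (Set.Iic x) = stdNormalCDF (x / √t) := by
  have h1 : gaussianReal 0 t.toNNReal = (gaussianReal 0 1).map (√t * ·) := by
    rw [gaussianReal_map_const_mul]
    congr 1
    · simp
    · ext; simp [Real.sq_sqrt ht.le, ht.le]
  have hs : 0 < √t := Real.sqrt_pos.2 ht
  unfold stdNormalCDF Measure.real
  rw [h1, Measure.map_apply (by fun_prop) measurableSet_Iic]
  congr 2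
  ext z
  simp [le_div_iff₀ hs, mul_comm]

lemma cdf_scale' (t : ℝ) (ht : 0 < t) (x : ℝ) :
    (gaussianReal 0 t.toNNReal).real (Set.Iio x) = stdNormalCDF (x / √t) := by
  rw [← cdf_scale t ht]
  have : NullSingletonClass (gaussianReal 0 t.toNNReal) := nullSingletonClass_gaussianReal (by simpa using ht)
  exact measureReal_congr Iio_ae_eq_Iic

lemma cdf_scale_ge (t : ℝ) (ht : 0 < t) (x : ℝ) :
    (gaussianReal 0 t.toNNReal).real (Set.Ici (-x)) = stdNormalCDF (x / √t) := by
  rw [← cdf_scale t ht]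
  have : gaussianReal 0 t.toNNReal = (gaussianReal 0 t.toNNReal).map (fun x => -x) := by
    rw [gaussianReal_map_neg]; simp
  conv_rhs => rw [this]
  rw [map_measureReal_apply (by fun_prop) measurableSet_Iic]
  congr 1
  ext z
  simp

/-- the payoff -/
noncomputable def ff (β x : ℝ) : ℝ := if x < 0 then - Real.exp (-2 * β * x) else 1

lemma ff_meas (β : ℝ) : Measurable (ff β) :=
  Measurable.ite measurableSet_Iio (by fun_prop) measurable_const

lemma ff_int (β x t : ℝ) : Integrable (fun z => ff β (x + z)) (gaussianReal 0 t.toNNReal) := by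
  have h : Integrable (fun z => Real.exp (-2 * β * x) * Real.exp ((-2 * β) * z) + 1)
      (gaussianReal 0 t.toNNReal) :=
    ((integrable_exp_mul_gaussianReal _).const_mul _).add (integrable_const _)
  refine h.mono' ((ff_meas β).comp (by fun_prop)).aestronglyMeasurable (.of_forall fun z => ?_)
  have : Real.exp (-2 * β * x) * Real.exp ((-2 * β) * z) = Real.exp (-2 * β * (x + z)) := by
    rw [← Real.exp_add]; ring_nf
  rw [this, Real.norm_eq_abs]
  unfold ff
  have := Real.exp_pos (-2 * β * (x + z))
  split_ifs
  · rw [abs_neg, abs_of_pos this]; linarith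
  · rw [abs_one]; linarith

lemma ff_integral (β x t : ℝ) (ht : 0 < t) :
    ∫ z, ff β (x + β * t + z) ∂(gaussianReal 0 t.toNNReal)
      = stdNormalCDF ((x + β * t) / √t) - Real.exp (-2 * β * x) * stdNormalCDF ((-x + β * t) / √t) := by
  have hne : t.toNNReal ≠ 0 := by simpa using ht
  have hi := ff_int β (x + β * t) t
  set y := x + β * t with hy
  rw [← integral_add_compl (measurableSet_Ici (a := -y)) hi]
  have e1 : ∫ z in Set.Ici (-y), ff β (y + z) ∂(gaussianReal 0 t.toNNReal)
      = stdNormalCDF (y / √t) := by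
    rw [← cdf_scale_ge t ht y, setIntegral_congr_fun (g := fun _ => (1:ℝ)) measurableSet_Ici]
    · simp
    · intro z hz
      have : -y ≤ z := hz
      simp only [ff]
      rw [if_neg (by linarith)]
  have e2 : ∫ z in (Set.Ici (-y))ᶜ, ff β (y + z) ∂(gaussianReal 0 t.toNNReal)
      = - (Real.exp (-2 * β * x) * stdNormalCDF ((-x + β * t) / √t)) := by
    rw [Set.compl_Ici, setIntegral_congr_fun (g := fun z => - Real.exp (-2 * β * (y + z))) measurableSet_Iio,
      integral_neg]
    swap
    · intro z hz
      have : z < -y := hz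
      simp only [ff]
      rw [if_pos (by linarith)]
    congr 1
    have hm : (gaussianReal (-(2 * β * t)) t.toNNReal).real (Set.Iio (-y)) = stdNormalCDF ((-x + β * t) / √t) := by
      rw [← cdf_scale' t ht]
      have : gaussianReal (-(2 * β * t)) t.toNNReal = (gaussianReal 0 t.toNNReal).map (· + -(2 * β * t)) := by
        rw [gaussianReal_map_add_const]; simp
      rw [this, map_measureReal_apply (by fun_prop) measurableSet_Iio]
      congr 1
      ext z
      simp only [Set.mem_preimage, Set.mem_Iio, hy]
      constructor <;> intro h <;> linarith
    rw [← hm]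
    have e3 : (gaussianReal (-(2 * β * t)) t.toNNReal).real (Set.Iio (-y))
        = ∫ z in Set.Iio (-y), gaussianPDFReal (-(2 * β * t)) t.toNNReal z := by
      have h := gaussianReal_apply_eq_integral (-(2 * β * t)) hne (Set.Iio (-y))
      unfold Measure.real
      rw [h, ENNReal.toReal_ofReal]
      exact integral_nonneg fun z => gaussianPDFReal_nonneg _ _ _
    rw [e3, ← integral_const_mul, gaussianReal_of_var_ne_zero _ hne,
      setIntegral_withDensity_eq_setIntegral_toReal_smul (measurable_gaussianPDF _ _)
        (by simp [gaussianPDF_lt_top]) _ measurableSet_Iio]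
    refine integral_congr_ae (.of_forall fun z => ?_)
    simp only [toReal_gaussianPDF, gaussianPDFReal, smul_eq_mul, Real.coe_toNNReal t ht.le]
    rw [mul_assoc, mul_left_comm (Real.exp _), ← Real.exp_add, ← Real.exp_add]
    congr 2
    field_simp
    rw [hy]
    ring
  rw [e1, e2]; ring

lemma cdf_bd (x : ℝ) : 0 ≤ stdNormalCDF x ∧ stdNormalCDF x ≤ 1 :=
  ⟨measureReal_nonneg, measureReal_le_one⟩

lemma ff_bound (β x t δ η : ℝ) (hη : 0 < η) (ht : η ≤ t) (hx : |x| ≤ δ) :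
    |∫ z, ff β (x + β * t + z) ∂(gaussianReal 0 t.toNNReal)|
      ≤ 2 * δ / √η + (Real.exp (2 * |β| * δ) - 1) := by
  have ht0 : 0 < t := by linarith
  rw [ff_integral β x t ht0]
  have h1 := cdf_lip ((-x + β * t) / √t) ((x + β * t) / √t)
  have h2 := cdf_bd ((-x + β * t) / √t)
  have hδ : 0 ≤ δ := (abs_nonneg x).trans hx
  have h3 : |(x + β * t) / √t - (-x + β * t) / √t| ≤ 2 * δ / √η := by
    rw [← sub_div, abs_div, abs_of_nonneg (Real.sqrt_nonneg t)]
    have : |x + β * t - (-x + β * t)| = 2 * |x| := by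
      rw [show x + β * t - (-x + β * t) = 2 * x by ring, abs_mul]; simp
    rw [this]
    have := Real.sqrt_pos.2 hη
    gcongr
  have h4 : |1 - Real.exp (-2 * β * x)| ≤ Real.exp (2 * |β| * δ) - 1 := by
    have hy : |-2 * β * x| ≤ 2 * |β| * δ := by
      rw [abs_mul, abs_mul]; simp; gcongr
    have g1 := Real.add_one_le_exp (-2 * β * x)
    have g2 := Real.add_one_le_exp (2 * |β| * δ)
    have g3 := Real.exp_le_exp.2 ((le_abs_self _).trans hy)
    have g4 := (neg_abs_le _ : -|-2 * β * x| ≤ _)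
    rw [abs_le]; constructor <;> linarith
  set p := stdNormalCDF ((x + β * t) / √t)
  set q := stdNormalCDF ((-x + β * t) / √t)
  calc |p - Real.exp (-2 * β * x) * q| = |(p - q) + (1 - Real.exp (-2 * β * x)) * q| := by ring_nf
    _ ≤ |p - q| + |(1 - Real.exp (-2 * β * x)) * q| := abs_add_le _ _
    _ = |p - q| + |1 - Real.exp (-2 * β * x)| * q := by rw [abs_mul, abs_of_nonneg h2.1]
    _ ≤ _ := by nlinarith [abs_nonneg (1 - Real.exp (-2 * β * x))]

lemma ind_eq {Ω : Type*} {S T : Set Ω} {f : Ω → ℝ} {ω : Ω} (h : ω ∈ S ↔ ω ∈ T) :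
    S.indicator f ω = T.indicator f ω := by
  classical
  simp only [Set.indicator_apply, h]

section BM

variable {Ω : Type*} [MeasurableSpace Ω]

lemma F_int (P : Measure Ω) [IsProbabilityMeasure P]
    (B : ℝ → Ω → ℝ)
    (hBmeas : ∀ t, Measurable (B t))
    (hB0 : ∀ᵐ ω ∂P, B 0 ω = 0)
    (hBincr : ∀ u v : ℝ, 0 ≤ u → u ≤ v →
      Measure.map (fun ω => B v ω - B u ω) P = gaussianReal 0 (Real.toNNReal (v - u)))
    (a β s : ℝ) (hs : 0 < s) :
    Integrable (fun ω => ff β (a + β * s + B s ω)) P ∧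
    ∫ ω, ff β (a + β * s + B s ω) ∂P = stdNormalCDF ((a + β * s) / √s)
        - Real.exp (-2 * β * a) * stdNormalCDF ((-a + β * s) / √s) := by
  have hm : Measurable (fun ω => B s ω - B 0 ω) := (hBmeas s).sub (hBmeas 0)
  have hl := hBincr 0 s le_rfl hs.le
  rw [sub_zero] at hl
  have hfm : Measurable (fun z => ff β (a + β * s + z)) := (ff_meas β).comp (by fun_prop)
  have hae : (fun ω => ff β (a + β * s + (B s ω - B 0 ω))) =ᵐ[P]
      (fun ω => ff β (a + β * s + B s ω)) := by
    filter_upwards [hB0] with ω h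
    rw [h, sub_zero]
  constructor
  · have := ff_int β (a + β * s) s
    rw [← hl, integrable_map_measure hfm.aestronglyMeasurable hm.aemeasurable] at this
    exact this.congr hae
  · rw [← integral_congr_ae hae, ← ff_integral β a s hs, ← hl,
      integral_map hm.aemeasurable hfm.aestronglyMeasurable]

lemma F_bound (P : Measure Ω) [IsProbabilityMeasure P]
    (B : ℝ → Ω → ℝ)
    (hBmeas : ∀ t, Measurable (B t))
    (hB0 : ∀ᵐ ω ∂P, B 0 ω = 0)
    (hBincr : ∀ u v : ℝ, 0 ≤ u → u ≤ v →
      Measure.map (fun ω => B v ω - B u ω) P = gaussianReal 0 (Real.toNNReal (v - u)))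
    (hBindep : ∀ u v : ℝ, 0 ≤ u → u ≤ v →
      Indep (MeasurableSpace.comap (fun ω => B v ω - B u ω) (borel ℝ))
        (⨆ w ∈ Set.Icc (0:ℝ) u, MeasurableSpace.comap (B w) (borel ℝ)) P)
    (a : ℝ) (ha : 0 < a) (β : ℝ) (s T : ℝ) (hT : 0 < T) (hTs : T < s) (δ : ℝ) (hδ : 0 < δ)
    (n : ℕ) :
    |∫ ω in {ω | ∃ k ∈ Finset.range (n + 2),
        a + β * (k * T / (n + 1)) + B (k * T / (n + 1)) ω < 0}, ff β (a + β * s + B s ω) ∂P|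
      ≤ (2 * δ / √(s - T) + (Real.exp (2 * |β| * δ) - 1))
        + ∫ ω in {ω | ∃ k ∈ Finset.range (n + 1),
          δ < |(a + β * ((k + 1 : ℕ) * T / (n + 1)) + B ((k + 1 : ℕ) * T / (n + 1)) ω)
            - (a + β * (k * T / (n + 1)) + B (k * T / (n + 1)) ω)|},
          |ff β (a + β * s + B s ω)| ∂P := by
  set c := 2 * δ / √(s - T) + (Real.exp (2 * |β| * δ) - 1) with hc
  have hs : 0 < s := hT.trans hTs
  obtain ⟨hint, -⟩ := F_int P B hBmeas hB0 hBincr a β s hs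
  set t : ℕ → ℝ := fun k => k * T / (n + 1) with ht
  set X : ℕ → Ω → ℝ := fun k ω => a + β * t k + B (t k) ω with hX
  have hn0 : (0:ℝ) < n + 1 := by positivity
  have ht0 : ∀ k, 0 ≤ t k := fun k => by simp only [ht]; positivity
  have htm : ∀ j k, j ≤ k → t j ≤ t k := fun j k h => by
    simp only [ht]; gcongr
  have htT : ∀ k ∈ Finset.range (n + 2), t k ≤ T := fun k hk => by
    simp only [ht]
    rw [div_le_iff₀ hn0, mul_comm]
    have : k ≤ n + 1 := by have := Finset.mem_range.1 hk; omega
    have : (k:ℝ) ≤ n + 1 := by exact_mod_cast this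
    gcongr
  have hXm : ∀ k, Measurable (X k) := fun k => (hBmeas _).const_add _
  change |∫ ω in {ω | ∃ k ∈ Finset.range (n + 2), X k ω < 0}, ff β (a + β * s + B s ω) ∂P|
      ≤ c + ∫ ω in {ω | ∃ k ∈ Finset.range (n + 1), δ < |X (k + 1) ω - X k ω|},
          |ff β (a + β * s + B s ω)| ∂P
  set F : Ω → ℝ := fun ω => ff β (a + β * s + B s ω) with hF
  set A : Set Ω := {ω | ∃ k ∈ Finset.range (n + 2), X k ω < 0} with hA
  set D : Set Ω := {ω | ∃ k ∈ Finset.range (n + 1), δ < |X (k + 1) ω - X k ω|} with hD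
  let G : ℕ → Set Ω := fun k => (X k ⁻¹' Set.Ico (-δ) 0) ∩ ⋂ j ∈ Finset.range k, X j ⁻¹' Set.Ici 0
  let m : ℝ → MeasurableSpace Ω := fun u =>
    ⨆ w ∈ Set.Icc (0:ℝ) u, MeasurableSpace.comap (B w) (borel ℝ)
  have hm : ∀ u, m u ≤ ‹MeasurableSpace Ω› := fun u =>
    iSup₂_le fun w _ => (hBmeas w).comap_le
  have hBm : ∀ u, ∀ w ∈ Set.Icc (0:ℝ) u, Measurable[m u] (B w) := fun u w hw => by
    have : MeasurableSpace.comap (B w) (borel ℝ) ≤ m u :=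
      le_iSup₂ (f := fun w (_ : w ∈ Set.Icc (0:ℝ) u) => MeasurableSpace.comap (B w) (borel ℝ)) w hw
    exact (measurable_iff_comap_le.2 this)
  have hXm' : ∀ k, ∀ j ≤ k, Measurable[m (t k)] (X j) := fun k j hj =>
    (hBm (t k) (t j) ⟨ht0 j, htm j k hj⟩).const_add _
  have hGm : ∀ k, MeasurableSet[m (t k)] (G k) := fun k => by
    refine MeasurableSet.inter (hXm' k k le_rfl measurableSet_Ico) ?_
    refine Finset.measurableSet_biInter _ fun j hj => ?_
    exact hXm' k j (Finset.mem_range.1 hj).le measurableSet_Ici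
  have hGm' : ∀ k, MeasurableSet (G k) := fun k => hm _ _ (hGm k)
  have hGb : ∀ k ∈ Finset.range (n + 2), |∫ ω in G k, F ω ∂P| ≤ c * P.real (G k) := by
    intro k hk
    have hts : t k ≤ s := (htT k hk).trans hTs.le
    have e : ∀ ω, F ω = ff β ((X k ω + β * (s - t k)) + (B s ω - B (t k) ω)) := fun ω => by
      simp only [hF, hX]; congr 1; ring
    have hint' := hint
    rw [funext e] at hint'
    rw [funext e]
    refine aux_indep (hm (t k)) P (fun ω => X k ω + β * (s - t k)) (fun ω => B s ω - B (t k) ω)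
      ((hXm' k k le_rfl).add_const _) ((hBmeas _).sub (hBmeas _)) (hBindep _ _ (ht0 k) hts) (G k)
      (hGm k) (ff β) (ff_meas β) c hint' ?_
    intro ω hω
    rw [hBincr _ _ (ht0 k) hts]
    refine ff_bound β (X k ω) (s - t k) δ (s - T) (by linarith) (by linarith [htT k hk]) ?_
    have := hω.1
    rw [Set.mem_preimage, Set.mem_Ico] at this
    rw [abs_le]; constructor <;> linarith
  have hdisj : Set.PairwiseDisjoint (↑(Finset.range (n + 2))) G := by
    have key : ∀ i j, i < j → Disjoint (G i) (G j) := fun i j hij => by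
      rw [Set.disjoint_left]
      intro ω h1 h2
      have h3 := Set.mem_iInter₂.1 h2.2 i (Finset.mem_range.2 hij)
      exact absurd h1.1.2 (not_lt.2 h3)
    intro i _ j _ hij
    rcases lt_or_gt_of_ne hij with h | h
    · exact key i j h
    · exact (key j i h).symm
  set U : Set Ω := ⋃ k ∈ Finset.range (n + 2), G k with hU
  have hUm : MeasurableSet U := Finset.measurableSet_biUnion _ fun k _ => hGm' k
  have hUb : |∫ ω in U, F ω ∂P| ≤ c := by
    rw [hU, integral_biUnion_finset _ (fun k _ => hGm' k) hdisj (fun k _ => hint.integrableOn)]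
    refine (Finset.abs_sum_le_sum_abs _ _).trans ((Finset.sum_le_sum hGb).trans ?_)
    rw [← Finset.mul_sum, ← measureReal_biUnion_finset hdisj (fun k _ => hGm' k)]
    have hc0 : 0 ≤ c := by
      have : 0 ≤ 2 * |β| * δ := by positivity
      have := Real.one_le_exp this
      have : 0 ≤ 2 * δ / √(s - T) := by positivity
      rw [hc]; linarith
    calc c * _ ≤ c * 1 := by gcongr; exact measureReal_le_one
      _ = c := mul_one c
  have hDm : MeasurableSet D := by
    have : D = ⋃ k ∈ Finset.range (n + 1), {ω | δ < |X (k + 1) ω - X k ω|} := by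
      ext; simp [hD]
    rw [this]
    exact Finset.measurableSet_biUnion _ fun k _ =>
      measurableSet_lt measurable_const ((hXm (k+1)).sub (hXm k)).abs
  have hAm : MeasurableSet A := by
    have : A = ⋃ k ∈ Finset.range (n + 2), {ω | X k ω < 0} := by
      ext; simp [hA]
    rw [this]
    exact Finset.measurableSet_biUnion _ fun k _ => measurableSet_lt (hXm k) measurable_const
  have hUA : U ⊆ A := by
    intro ω hω
    obtain ⟨k, hk, hω⟩ := Set.mem_iUnion₂.1 hω
    exact ⟨k, hk, hω.1.2⟩
  have hsub : ∀ᵐ ω ∂P, ω ∈ A \ U → ω ∈ D := by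
    filter_upwards [hB0] with ω h0 hω
    obtain ⟨hωA, hωU⟩ := hω
    classical
    have hex : ∃ k, k ∈ Finset.range (n + 2) ∧ X k ω < 0 := hωA
    have h1 := Nat.find_spec hex
    have h2 := fun j => Nat.find_min hex (m := j)
    generalize Nat.find hex = k at h1 h2
    have h3 : ∀ j < k, 0 ≤ X j ω := fun j hj => by
      by_contra h
      exact h2 j hj ⟨Finset.mem_range.2 (hj.trans (Finset.mem_range.1 h1.1)), not_le.1 h⟩
    have h4 : X k ω < -δ := by
      by_contra h
      refine hωU (Set.mem_iUnion₂.2 ⟨k, h1.1, ⟨not_lt.1 h, h1.2⟩, Set.mem_iInter₂.2 ?_⟩)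
      exact fun j hj => h3 j (Finset.mem_range.1 hj)
    rcases k with _ | k
    · exfalso
      have := h1.2
      simp only [hX, ht] at this
      simp [h0] at this
      linarith
    · have h5 := h3 k (Nat.lt_succ_self k)
      refine ⟨k, ?_, ?_⟩
      · have := Finset.mem_range.1 h1.1
        exact Finset.mem_range.2 (by omega)
      · rw [abs_sub_comm]
        exact lt_of_lt_of_le (by linarith) (le_abs_self _)
  have hsplit : ∫ ω in A, F ω ∂P = ∫ ω in U, F ω ∂P + ∫ ω in A \ U, F ω ∂P := by
    rw [← setIntegral_union Set.disjoint_sdiff_right (hAm.diff hUm) hint.integrableOn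
      hint.integrableOn, Set.union_sdiff_cancel hUA]
  rw [hsplit]
  refine (abs_add_le _ _).trans (add_le_add hUb ?_)
  refine (abs_integral_le_integral_abs).trans ?_
  refine setIntegral_mono_set hint.abs.integrableOn (.of_forall fun _ => abs_nonneg _) ?_
  filter_upwards [hsub] with ω h using h


lemma grid_meas (B : ℝ → Ω → ℝ) (hBmeas : ∀ t, Measurable (B t)) (a β T : ℝ) (n : ℕ) :
    MeasurableSet {ω | ∃ k ∈ Finset.range (n + 2),
        a + β * (k * T / (n + 1)) + B (k * T / (n + 1)) ω < 0} := by
  have : {ω | ∃ k ∈ Finset.range (n + 2), a + β * (k * T / (n + 1)) + B (k * T / (n + 1)) ω < 0}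
      = ⋃ k ∈ Finset.range (n + 2), {ω | a + β * (k * T / (n + 1)) + B (k * T / (n + 1)) ω < 0} := by
    ext; simp
  rw [this]
  exact Finset.measurableSet_biUnion _ fun k _ =>
    measurableSet_lt ((hBmeas _).const_add _) measurable_const

lemma path_cont (B : ℝ → Ω → ℝ) (a β T : ℝ) (ω : Ω)
    (h : ContinuousOn (fun t => B t ω) (Set.Ici 0)) :
    ContinuousOn (fun u => a + β * u + B u ω) (Set.Icc 0 T) :=
  ContinuousOn.add (by fun_prop) (h.mono Set.Icc_subset_Ici_self)

lemma grid_sub (B : ℝ → Ω → ℝ) (a β T : ℝ) (hT : 0 < T) (n : ℕ) (ω : Ω)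
    (h : ∃ k ∈ Finset.range (n + 2), a + β * (k * T / (n + 1)) + B (k * T / (n + 1)) ω < 0) :
    ∃ u ∈ Set.Icc 0 T, a + β * u + B u ω < 0 := by
  obtain ⟨k, hk, h⟩ := h
  refine ⟨_, ⟨by positivity, ?_⟩, h⟩
  have hn0 : (0:ℝ) < n + 1 := by positivity
  rw [div_le_iff₀ hn0, mul_comm]
  have : k ≤ n + 1 := by have := Finset.mem_range.1 hk; omega
  have : (k:ℝ) ≤ n + 1 := by exact_mod_cast this
  gcongr

lemma A_null (P : Measure Ω) (B : ℝ → Ω → ℝ) (hBmeas : ∀ t, Measurable (B t))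
    (hBcont : ∀ᵐ ω ∂P, ContinuousOn (fun t => B t ω) (Set.Ici 0))
    (a β T : ℝ) (hT : 0 < T) :
    NullMeasurableSet {ω | ∃ u ∈ Set.Icc 0 T, a + β * u + B u ω < 0} P := by
  have h1 : MeasurableSet (⋃ n : ℕ, {ω | ∃ k ∈ Finset.range (n + 2),
        a + β * (k * T / (n + 1)) + B (k * T / (n + 1)) ω < 0}) :=
    MeasurableSet.iUnion fun n => grid_meas B hBmeas a β T n
  refine h1.nullMeasurableSet.congr ?_
  filter_upwards [hBcont] with ω hω
  refine propext ⟨fun h => ?_, fun h => ?_⟩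
  · obtain ⟨n, h⟩ := Set.mem_iUnion.1 h
    exact grid_sub B a β T hT n ω h
  · obtain ⟨u, hu, h⟩ := h
    obtain ⟨n, hn⟩ := (aux_grid _ T hT (path_cont B a β T ω hω) u hu h).exists
    exact Set.mem_iUnion.2 ⟨n, hn⟩

lemma A_zero (P : Measure Ω) [IsProbabilityMeasure P]
    (B : ℝ → Ω → ℝ)
    (hBmeas : ∀ t, Measurable (B t))
    (hB0 : ∀ᵐ ω ∂P, B 0 ω = 0)
    (hBcont : ∀ᵐ ω ∂P, ContinuousOn (fun t => B t ω) (Set.Ici 0))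
    (hBincr : ∀ u v : ℝ, 0 ≤ u → u ≤ v →
      Measure.map (fun ω => B v ω - B u ω) P = gaussianReal 0 (Real.toNNReal (v - u)))
    (hBindep : ∀ u v : ℝ, 0 ≤ u → u ≤ v →
      Indep (MeasurableSpace.comap (fun ω => B v ω - B u ω) (borel ℝ))
        (⨆ w ∈ Set.Icc (0:ℝ) u, MeasurableSpace.comap (B w) (borel ℝ)) P)
    (a : ℝ) (ha : 0 < a) (β : ℝ) (s T : ℝ) (hT : 0 < T) (hTs : T < s) :
    ∫ ω, Set.indicator {ω | ∃ u ∈ Set.Icc 0 T, a + β * u + B u ω < 0}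
      (fun ω => ff β (a + β * s + B s ω)) ω ∂P = 0 := by
  obtain ⟨hint, -⟩ := F_int P B hBmeas hB0 hBincr a β s (hT.trans hTs)
  have key : ∀ δ : ℝ, 0 < δ → |∫ ω, Set.indicator {ω | ∃ u ∈ Set.Icc 0 T, a + β * u + B u ω < 0}
      (fun ω => ff β (a + β * s + B s ω)) ω ∂P|
      ≤ 2 * δ / √(s - T) + (Real.exp (2 * |β| * δ) - 1) := by
    intro δ hδ
    have hDm : ∀ n : ℕ, MeasurableSet {ω | ∃ k ∈ Finset.range (n + 1),
          δ < |(a + β * ((k + 1 : ℕ) * T / (n + 1)) + B ((k + 1 : ℕ) * T / (n + 1)) ω)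
            - (a + β * (k * T / (n + 1)) + B (k * T / (n + 1)) ω)|} := by
      intro n
      have : {ω | ∃ k ∈ Finset.range (n + 1),
          δ < |(a + β * ((k + 1 : ℕ) * T / (n + 1)) + B ((k + 1 : ℕ) * T / (n + 1)) ω)
            - (a + β * (k * T / (n + 1)) + B (k * T / (n + 1)) ω)|}
          = ⋃ k ∈ Finset.range (n + 1), {ω |
          δ < |(a + β * ((k + 1 : ℕ) * T / (n + 1)) + B ((k + 1 : ℕ) * T / (n + 1)) ω)
            - (a + β * (k * T / (n + 1)) + B (k * T / (n + 1)) ω)|} := by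
        ext; simp
      rw [this]
      exact Finset.measurableSet_biUnion _ fun k _ => measurableSet_lt measurable_const
        (((hBmeas _).const_add _).sub ((hBmeas _).const_add _)).abs
    have hb := F_bound P B hBmeas hB0 hBincr hBindep a ha β s T hT hTs δ hδ
    simp only [← integral_indicator (grid_meas B hBmeas a β T _),
      ← integral_indicator (hDm _)] at hb
    have l1 : Filter.Tendsto (fun n : ℕ => ∫ ω, Set.indicator {ω | ∃ k ∈ Finset.range (n + 2),
        a + β * (k * T / (n + 1)) + B (k * T / (n + 1)) ω < 0}
        (fun ω => ff β (a + β * s + B s ω)) ω ∂P) Filter.atTop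
        (nhds (∫ ω, Set.indicator {ω | ∃ u ∈ Set.Icc 0 T, a + β * u + B u ω < 0}
          (fun ω => ff β (a + β * s + B s ω)) ω ∂P)) := by
      refine tendsto_integral_of_dominated_convergence _
        (fun n => hint.aestronglyMeasurable.indicator (grid_meas B hBmeas a β T n)) hint.norm
        (fun n => .of_forall fun ω => norm_indicator_le_norm_self _ _) ?_
      filter_upwards [hBcont] with ω hω
      by_cases hA : ∃ u ∈ Set.Icc 0 T, a + β * u + B u ω < 0
      · obtain ⟨u, hu, h⟩ := hA
        refine tendsto_const_nhds.congr' ?_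
        filter_upwards [aux_grid _ T hT (path_cont B a β T ω hω) u hu h] with n hn
        exact ind_eq ⟨fun _ => hn, fun _ => ⟨u, hu, h⟩⟩
      · refine tendsto_const_nhds.congr fun n => ?_
        exact ind_eq ⟨fun h => absurd h hA, fun h => grid_sub B a β T hT n ω h⟩
    have l2 : Filter.Tendsto (fun n : ℕ => ∫ ω, Set.indicator {ω | ∃ k ∈ Finset.range (n + 1),
          δ < |(a + β * ((k + 1 : ℕ) * T / (n + 1)) + B ((k + 1 : ℕ) * T / (n + 1)) ω)
            - (a + β * (k * T / (n + 1)) + B (k * T / (n + 1)) ω)|}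
        (fun ω => |ff β (a + β * s + B s ω)|) ω ∂P) Filter.atTop
        (nhds (∫ ω, (0:ℝ) ∂P)) := by
      refine tendsto_integral_of_dominated_convergence _
        (fun n => hint.abs.aestronglyMeasurable.indicator (hDm n)) hint.abs.norm
        (fun n => .of_forall fun ω => norm_indicator_le_norm_self _ _) ?_
      filter_upwards [hBcont] with ω hω
      refine tendsto_const_nhds.congr' ?_
      filter_upwards [aux_unif _ T hT (path_cont B a β T ω hω) δ hδ] with n hn
      rw [Set.indicator_of_notMem]
      rintro ⟨k, hk, h⟩
      exact absurd h (not_lt.2 (hn k hk))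
    rw [integral_zero] at l2
    have := le_of_tendsto_of_tendsto' l1.abs (l2.const_add _) hb
    simpa using this
  have hc : Filter.Tendsto (fun δ : ℝ => 2 * δ / √(s - T) + (Real.exp (2 * |β| * δ) - 1))
      (nhdsWithin 0 (Set.Ioi 0)) (nhds 0) := by
    have : Continuous (fun δ : ℝ => 2 * δ / √(s - T) + (Real.exp (2 * |β| * δ) - 1)) := by fun_prop
    have h := this.tendsto 0
    simp only [mul_zero, zero_div, Real.exp_zero, sub_self, add_zero] at h
    exact h.mono_left nhdsWithin_le_nhds
  have : |_| ≤ (0:ℝ) := ge_of_tendsto hc (by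
    filter_upwards [self_mem_nhdsWithin] with δ hδ using key δ hδ)
  exact abs_nonpos_iff.1 this

lemma q_eq (P : Measure Ω) [IsProbabilityMeasure P]
    (B : ℝ → Ω → ℝ)
    (hBmeas : ∀ t, Measurable (B t))
    (hB0 : ∀ᵐ ω ∂P, B 0 ω = 0)
    (hBcont : ∀ᵐ ω ∂P, ContinuousOn (fun t => B t ω) (Set.Ici 0))
    (hBincr : ∀ u v : ℝ, 0 ≤ u → u ≤ v →
      Measure.map (fun ω => B v ω - B u ω) P = gaussianReal 0 (Real.toNNReal (v - u)))
    (hBindep : ∀ u v : ℝ, 0 ≤ u → u ≤ v →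
      Indep (MeasurableSpace.comap (fun ω => B v ω - B u ω) (borel ℝ))
        (⨆ w ∈ Set.Icc (0:ℝ) u, MeasurableSpace.comap (B w) (borel ℝ)) P)
    (a : ℝ) (ha : 0 < a) (β : ℝ) (s : ℝ) (hs : 0 < s) :
    P.real {ω | ∀ u ∈ Set.Icc 0 s, 0 ≤ a + β * u + B u ω}
      = stdNormalCDF ((a + β * s) / √s)
        - Real.exp (-2 * β * a) * stdNormalCDF ((-a + β * s) / √s) := by
  obtain ⟨hint, hval⟩ := F_int P B hBmeas hB0 hBincr a β s hs
  have hAs := A_null P B hBmeas hBcont a β s hs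
  have hzero : ∫ ω, Set.indicator {ω | ∃ u ∈ Set.Icc 0 s, a + β * u + B u ω < 0}
      (fun ω => ff β (a + β * s + B s ω)) ω ∂P = 0 := by
    have hTn : ∀ n : ℕ, 0 < s * (1 - 1 / ((n:ℝ) + 2)) ∧ s * (1 - 1 / ((n:ℝ) + 2)) < s := by
      intro n
      have h1 : 1 / ((n:ℝ) + 2) < 1 := by rw [div_lt_one (by positivity)]; linarith [n.cast_nonneg (α := ℝ)]
      have h2 : 0 < 1 / ((n:ℝ) + 2) := by positivity
      constructor
      · exact mul_pos hs (by linarith)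
      · nlinarith
    have hTl : Filter.Tendsto (fun n : ℕ => s * (1 - 1 / ((n:ℝ) + 2))) Filter.atTop (nhds s) := by
      have h := ((tendsto_one_div_add_atTop_nhds_zero_nat (𝕜 := ℝ)).comp
        (Filter.tendsto_add_atTop_nat 1)).const_sub 1 |>.const_mul s
      simp only [sub_zero, mul_one] at h
      refine h.congr fun n => ?_
      simp only [Function.comp]
      push_cast
      ring_nf
    have l1 : Filter.Tendsto (fun n : ℕ => ∫ ω, Set.indicator {ω | ∃ u ∈ Set.Icc 0
        (s * (1 - 1 / ((n:ℝ) + 2))), a + β * u + B u ω < 0}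
        (fun ω => ff β (a + β * s + B s ω)) ω ∂P) Filter.atTop
        (nhds (∫ ω, Set.indicator {ω | ∃ u ∈ Set.Icc 0 s, a + β * u + B u ω < 0}
          (fun ω => ff β (a + β * s + B s ω)) ω ∂P)) := by
      refine tendsto_integral_of_dominated_convergence _
        (fun n => hint.aestronglyMeasurable.indicator₀
          (A_null P B hBmeas hBcont a β _ (hTn n).1)) hint.norm
        (fun n => .of_forall fun ω => norm_indicator_le_norm_self _ _) ?_
      filter_upwards [hBcont] with ω hω
      by_cases hA : ∃ u ∈ Set.Icc 0 s, a + β * u + B u ω < 0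
      · have hA2 : ∃ u ∈ Set.Ico 0 s, a + β * u + B u ω < 0 := by
          obtain ⟨u, hu, h⟩ := hA
          by_contra! hcon
          have hus : u = s := by
            by_contra hne
            exact absurd (hcon u ⟨hu.1, lt_of_le_of_ne hu.2 hne⟩) (not_le.2 h)
          subst hus
          have hcw := (path_cont B a β u ω hω) u hu
          have : Filter.Tendsto (fun n : ℕ => a + β * (u * (1 - 1 / ((n:ℝ) + 2)))
              + B (u * (1 - 1 / ((n:ℝ) + 2))) ω) Filter.atTop (nhds (a + β * u + B u ω)) :=
            hcw.tendsto.comp (tendsto_nhdsWithin_iff.2 ⟨hTl,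
              .of_forall fun n => ⟨(hTn n).1.le, (hTn n).2.le⟩⟩)
          have := ge_of_tendsto' this fun n => hcon _ ⟨(hTn n).1.le, (hTn n).2⟩
          linarith
        obtain ⟨u, hu, h⟩ := hA2
        refine tendsto_const_nhds.congr' ?_
        filter_upwards [hTl.eventually (lt_mem_nhds hu.2)] with n hn
        exact ind_eq ⟨fun _ => ⟨u, ⟨hu.1, hn.le⟩, h⟩, fun _ => hA⟩
      · refine tendsto_const_nhds.congr fun n => ?_
        exact ind_eq ⟨fun h => absurd h hA, fun ⟨u, hu, h⟩ =>
          ⟨u, ⟨hu.1, hu.2.trans (hTn n).2.le⟩, h⟩⟩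
    refine tendsto_nhds_unique l1 (tendsto_const_nhds.congr fun n => ?_)
    rw [A_zero P B hBmeas hB0 hBcont hBincr hBindep a ha β s _ (hTn n).1 (hTn n).2]
  rw [integral_indicator₀ hAs] at hzero
  rw [← hval, ← integral_add_compl₀ hAs hint, hzero, zero_add]
  have hcompl : {ω | ∃ u ∈ Set.Icc 0 s, a + β * u + B u ω < 0}ᶜ
      = {ω | ∀ u ∈ Set.Icc 0 s, 0 ≤ a + β * u + B u ω} := by
    ext ω; simp
  have hone : ∫ ω in {ω | ∃ u ∈ Set.Icc 0 s, a + β * u + B u ω < 0}ᶜ, ff β (a + β * s + B s ω) ∂P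
      = ∫ ω in {ω | ∃ u ∈ Set.Icc 0 s, a + β * u + B u ω < 0}ᶜ, (1:ℝ) ∂P := by
    refine integral_congr_ae ?_
    filter_upwards [ae_restrict_mem₀ hAs.compl] with ω hω
    rw [hcompl] at hω
    exact if_neg (not_lt.2 (hω s ⟨hs.le, le_rfl⟩))
  rw [hone, hcompl]
  simp

end BM

/-- Let `(B_t)_{t≥0}` be a standard Brownian motion on a probability space `(Ω, 𝒜, P)`:
`B_0 = 0` a.s., a.s. continuous sample paths, and for `0 ≤ u ≤ v` the increment
`B_v − B_u` is `N(0, v − u)`-distributed and independent of the σ-algebra generated by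
`(B_w)_{w ≤ u}`.  Then for every `a > 0`, `β ∈ ℝ` and `s > 0`,
`P(∀ u ∈ [0,s], a + β·u + B_u > 0)
  = Φ((a + β·s)/√s) − exp(−2·β·a)·Φ((−a + β·s)/√s)`.
(Analytic core of the AT1P survival probability formula (survcoher).) -/
theorem brownian_drift_stays_positive_probability
    {Ω : Type*} [MeasurableSpace Ω] (P : Measure Ω) [IsProbabilityMeasure P]
    (B : ℝ → Ω → ℝ)
    (hBmeas : ∀ t, Measurable (B t))
    (hB0 : ∀ᵐ ω ∂P, B 0 ω = 0)
    (hBcont : ∀ᵐ ω ∂P, ContinuousOn (fun t => B t ω) (Set.Ici 0))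
    (hBincr : ∀ u v : ℝ, 0 ≤ u → u ≤ v →
      Measure.map (fun ω => B v ω - B u ω) P = gaussianReal 0 (Real.toNNReal (v - u)))
    (hBindep : ∀ u v : ℝ, 0 ≤ u → u ≤ v →
      Indep (MeasurableSpace.comap (fun ω => B v ω - B u ω) (borel ℝ))
        (⨆ w ∈ Set.Icc (0:ℝ) u, MeasurableSpace.comap (B w) (borel ℝ)) P)
    (a : ℝ) (ha : 0 < a) (β : ℝ) (s : ℝ) (hs : 0 < s) :
    (P {ω | ∀ u ∈ Set.Icc (0:ℝ) s, 0 < a + β * u + B u ω}).toReal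
      = stdNormalCDF ((a + β * s) / Real.sqrt s)
        - Real.exp (-2 * β * a) * stdNormalCDF ((-a + β * s) / Real.sqrt s) := by
  set g : ℝ → ℝ := fun a => stdNormalCDF ((a + β * s) / Real.sqrt s)
        - Real.exp (-2 * β * a) * stdNormalCDF ((-a + β * s) / Real.sqrt s) with hg
  have hgc : Continuous g := by
    have h := cdf_cont
    refine (h.comp (by fun_prop)).sub (Continuous.mul (by fun_prop) (h.comp (by fun_prop)))
  have hq := fun a ha => q_eq P B hBmeas hB0 hBcont hBincr hBindep a ha β s hs
  change P.real _ = g a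
  refine le_antisymm ?_ ?_
  · refine le_trans (measureReal_mono ?_) (hq a ha).le
    exact fun ω h u hu => (h u hu).le
  · have hl : Filter.Tendsto g (nhdsWithin a (Set.Iio a)) (nhds (g a)) :=
      (hgc.tendsto a).mono_left nhdsWithin_le_nhds
    refine le_of_tendsto hl ?_
    have h1 : ∀ᶠ b in nhdsWithin a (Set.Iio a), 0 < b :=
      nhdsWithin_le_nhds (lt_mem_nhds ha)
    filter_upwards [h1, self_mem_nhdsWithin] with b hb hba
    refine (hq b hb).symm.le.trans (measureReal_mono ?_)
    intro ω h u hu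
    have h2 := h u hu
    have h3 : b < a := hba
    linarith
end

section
/- For every a > 0, every s > 0 and every β ∈ ℝ, the AT1P survival probability expression is a nondegenerate probability: 0 < Φ((a + β·s)/√s) − exp(−2·β·a)·Φ((−a + β·s)/√s) < 1. -/
open MeasureTheory ProbabilityTheory

lemma stdNormalCDF_shift (x d : ℝ) :
    stdNormalCDF (x + d) = ∫ u in Set.Iic d, gaussianPDFReal 0 1 (u + x) := by
  have h := (measurePreserving_add_right volume x).setIntegral_preimage_emb
    (MeasurableEquiv.addRight x).measurableEmbedding (gaussianPDFReal 0 1) (Set.Iic (x + d))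
  have e : (fun u : ℝ => u + x) ⁻¹' Set.Iic (x + d) = Set.Iic d := by
    ext u; simp [add_comm x d]
  rw [e] at h
  rw [h, stdNormalCDF, gaussianReal_apply_eq_integral 0 one_ne_zero, ENNReal.toReal_ofReal]
  exact integral_nonneg (fun u => gaussianPDFReal_nonneg _ _ _)

lemma stdNormalCDF_lt_one (x : ℝ) : stdNormalCDF x < 1 := by
  have hpos : gaussianReal 0 1 (Set.Ioi x) ≠ 0 := by
    intro h
    have := gaussianReal_absolutelyContinuous' 0 (v := 1) one_ne_zero h
    simp at this
  have h := measureReal_add_measureReal_compl (μ := gaussianReal 0 1) (measurableSet_Iic (a := x))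
  rw [Set.compl_Iic, probReal_univ] at h
  have h2 : 0 < (gaussianReal 0 1).real (Set.Ioi x) :=
    ENNReal.toReal_pos hpos (measure_ne_top _ _)
  have h3 : stdNormalCDF x = (gaussianReal 0 1).real (Set.Iic x) := rfl
  linarith

lemma stdNormalCDF_key (c d : ℝ) (hc : 0 < c) :
    0 < stdNormalCDF (c + d) - Real.exp (-2 * (c * d)) * stdNormalCDF (-c + d) := by
  have hi : ∀ x : ℝ, Integrable (fun u => gaussianPDFReal 0 1 (u + x)) := fun x =>
    (integrable_gaussianPDFReal 0 1).comp_add_right x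
  have hlt : ∀ u < d, Real.exp (-2 * (c * d)) * gaussianPDFReal 0 1 (u + -c)
      < gaussianPDFReal 0 1 (u + c) := by
    intro u hu
    simp only [gaussianPDFReal_def]
    rw [mul_left_comm, ← Real.exp_add]
    apply mul_lt_mul_of_pos_left
    · apply Real.exp_lt_exp.2
      simp only [NNReal.coe_one]
      nlinarith [mul_pos hc (sub_pos.2 hu)]
    · simp; positivity
  rw [stdNormalCDF_shift, stdNormalCDF_shift, ← integral_const_mul,
    ← integral_sub (hi c).integrableOn ((hi (-c)).integrableOn.const_mul _),
    integral_Iic_eq_integral_Iio]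
  rw [setIntegral_pos_iff_support_of_nonneg_ae]
  · apply lt_of_lt_of_le (b := volume (Set.Iio d))
    · simp
    · apply measure_mono
      intro u hu
      exact ⟨(sub_pos.2 (hlt u hu)).ne', hu⟩
  · filter_upwards [ae_restrict_mem measurableSet_Iio] with u hu
    exact (sub_pos.2 (hlt u hu)).le
  · exact ((hi c).sub ((hi (-c)).const_mul _)).integrableOn

/-- For every `a > 0`, `s > 0` and `β ∈ ℝ`, the AT1P survival probability expression
is a nondegenerate probability:
`0 < Φ((a + β·s)/√s) − exp(−2·β·a)·Φ((−a + β·s)/√s) < 1`. -/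
theorem at1p_survival_nondegenerate (a s β : ℝ) (ha : 0 < a) (hs : 0 < s) :
    0 < stdNormalCDF ((a + β * s) / Real.sqrt s)
        - Real.exp (-2 * β * a) * stdNormalCDF ((-a + β * s) / Real.sqrt s)
    ∧ stdNormalCDF ((a + β * s) / Real.sqrt s)
        - Real.exp (-2 * β * a) * stdNormalCDF ((-a + β * s) / Real.sqrt s) < 1 := by
  have hq : 0 < Real.sqrt s := Real.sqrt_pos.2 hs
  constructor
  · have h := stdNormalCDF_key (a / Real.sqrt s) (β * s / Real.sqrt s) (div_pos ha hq)
    have e1 : a / Real.sqrt s * (β * s / Real.sqrt s) = β * a := by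
      have := Real.mul_self_sqrt hs.le
      rw [div_mul_div_comm, this]
      field_simp
    rw [e1, ← neg_div, ← add_div, ← add_div, ← mul_assoc] at h
    exact h
  · have h1 := stdNormalCDF_lt_one ((a + β * s) / Real.sqrt s)
    have h2 : 0 ≤ Real.exp (-2 * β * a) * stdNormalCDF ((-a + β * s) / Real.sqrt s) :=
      mul_nonneg (Real.exp_pos _).le ENNReal.toReal_nonneg
    linarith
end

section
/- Fix β ∈ ℝ and s > 0, and define ψ : (0, 1) → ℝ by ψ(H) = Φ((−log H + β·s)/√s) − H^{2β}·Φ((log H + β·s)/√s). Then ψ is strictly decreasing on (0, 1). (This is the monotonicity in H, used in the 'credit spread based' method for determining the barrier parameter H by solving ψ(H) = exp(−∫₀^T λ_CDS(u) du) numerically: since ψ is monotonic the equation has at most one solution.) -/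
open MeasureTheory ProbabilityTheory

theorem aux_cdf_eq (x : ℝ) : stdNormalCDF x = ∫ u in Set.Iic x, gaussianPDFReal 0 1 u := by
  unfold stdNormalCDF
  rw [gaussianReal_apply_eq_integral 0 (by norm_num : (1 : NNReal) ≠ 0),
    ENNReal.toReal_ofReal]
  exact integral_nonneg fun u => gaussianPDFReal_nonneg 0 1 u

theorem aux_pdf_cont : Continuous (gaussianPDFReal 0 1) := by
  unfold gaussianPDFReal
  fun_prop

theorem aux_cdf_hasDerivAt (x : ℝ) : HasDerivAt stdNormalCDF (gaussianPDFReal 0 1 x) x := by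
  have h : stdNormalCDF = fun y => stdNormalCDF 0 + ∫ u in (0:ℝ)..y, gaussianPDFReal 0 1 u := by
    funext y
    rw [aux_cdf_eq, aux_cdf_eq, ← intervalIntegral.integral_Iic_sub_Iic
      (integrable_gaussianPDFReal 0 1).integrableOn (integrable_gaussianPDFReal 0 1).integrableOn]
    ring
  rw [h]
  exact (intervalIntegral.integral_hasDerivAt_right (aux_pdf_cont.intervalIntegrable _ _)
    aux_pdf_cont.stronglyMeasurable.stronglyMeasurableAtFilter
    aux_pdf_cont.continuousAt).const_add _

theorem aux_pdf_formula (x : ℝ) :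
    gaussianPDFReal 0 1 x = (√(2 * Real.pi))⁻¹ * Real.exp (-(1/2) * x ^ 2) := by
  simp only [gaussianPDFReal, NNReal.coe_one, mul_one, sub_zero]
  congr 2
  ring

theorem aux_pdf_hasDerivAt (x : ℝ) :
    HasDerivAt (gaussianPDFReal 0 1) (-x * gaussianPDFReal 0 1 x) x := by
  have h : gaussianPDFReal 0 1 = fun x => (√(2 * Real.pi))⁻¹ * Real.exp (-(1/2) * x ^ 2) :=
    funext aux_pdf_formula
  rw [aux_pdf_formula x, h]
  refine HasDerivAt.congr_deriv (((((hasDerivAt_id' x).pow 2).const_mul (-(1/2) : ℝ)).exp).const_mul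
    ((√(2 * Real.pi))⁻¹)) ?_
  simp only [Pi.pow_apply]
  push_cast
  ring

theorem aux_cdf_pos (x : ℝ) : 0 < stdNormalCDF x := by
  rw [aux_cdf_eq, setIntegral_pos_iff_support_of_nonneg_ae]
  · have : Function.support (gaussianPDFReal 0 1) = Set.univ := by
      ext u
      simp [(gaussianPDFReal_pos 0 1 u (by norm_num)).ne']
    rw [this]
    simp
  · exact Filter.Eventually.of_forall fun u => gaussianPDFReal_nonneg 0 1 u
  · exact (integrable_gaussianPDFReal 0 1).integrableOn

theorem aux_mills (b : ℝ) : -b * stdNormalCDF b ≤ gaussianPDFReal 0 1 b := by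
  have hint : Integrable (fun u => -u * gaussianPDFReal 0 1 u) := by
    have := (integrable_mul_exp_neg_mul_sq (b := 1/2) (by norm_num)).const_mul
      (-(√(2 * Real.pi))⁻¹)
    refine this.congr (Filter.Eventually.of_forall fun u => ?_)
    simp only [aux_pdf_formula]
    ring
  have hlim : Filter.Tendsto (gaussianPDFReal 0 1) Filter.atBot (nhds 0) := by
    have h : gaussianPDFReal 0 1 = fun x => (√(2 * Real.pi))⁻¹ * Real.exp (-(1/2) * x ^ 2) :=
      funext aux_pdf_formula
    rw [h, show (0:ℝ) = (√(2 * Real.pi))⁻¹ * 0 by ring]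
    refine Filter.Tendsto.const_mul _ (Real.tendsto_exp_atBot.comp ?_)
    refine Filter.Tendsto.const_mul_atTop_of_neg (by norm_num) ?_
    have h2 := (Filter.tendsto_pow_atTop (α := ℝ) (two_ne_zero)).comp
      (Filter.tendsto_neg_atBot_atTop (G := ℝ))
    exact h2.congr fun x => by simp
  have hI := integral_Iic_of_hasDerivAt_of_tendsto' (a := b)
    (fun u _ => aux_pdf_hasDerivAt u) hint.integrableOn hlim
  rw [sub_zero] at hI
  rw [← hI, aux_cdf_eq, ← integral_const_mul]
  refine setIntegral_mono_on ((integrable_gaussianPDFReal 0 1).const_mul _).integrableOn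
    hint.integrableOn measurableSet_Iic fun u hu => ?_
  exact mul_le_mul_of_nonneg_right (neg_le_neg hu) (gaussianPDFReal_nonneg 0 1 u)

theorem aux_key (β s H : ℝ) (hs : 0 < s) (h0 : 0 < H) (h1 : H < 1) :
    0 < gaussianPDFReal 0 1 ((Real.log H + β * s) / √s) / √s
      + β * stdNormalCDF ((Real.log H + β * s) / √s) := by
  have hr : 0 < √s := Real.sqrt_pos.2 hs
  set b := (Real.log H + β * s) / √s with hb
  have hlog := Real.log_neg h0 h1
  have hlt : b < β * √s := by
    rw [hb, div_lt_iff₀ hr, mul_assoc, Real.mul_self_sqrt hs.le]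
    linarith
  have hm := aux_mills b
  have hp := mul_pos (sub_pos.2 hlt) (aux_cdf_pos b)
  have : gaussianPDFReal 0 1 b / √s + β * stdNormalCDF b
      = (gaussianPDFReal 0 1 b + β * √s * stdNormalCDF b) / √s := by
    field_simp
  rw [this]
  refine div_pos ?_ hr
  linarith

theorem aux_sym (β s H : ℝ) (hs : 0 < s) (h0 : 0 < H) :
    gaussianPDFReal 0 1 ((-Real.log H + β * s) / √s)
      = H ^ (2 * β) * gaussianPDFReal 0 1 ((Real.log H + β * s) / √s) := by
  rw [aux_pdf_formula, aux_pdf_formula, Real.rpow_def_of_pos h0, mul_left_comm, ← Real.exp_add]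
  congr 2
  rw [div_pow, div_pow, Real.sq_sqrt hs.le]
  field_simp
  ring

/-- Fix `β ∈ ℝ` and `s > 0`, and define `ψ : (0,1) → ℝ` by
`ψ(H) = Φ((−log H + β·s)/√s) − H^{2β}·Φ((log H + β·s)/√s)`.
Then `ψ` is strictly decreasing on `(0,1)`.  This is the monotonicity in `H` used in the
credit-spread-based method for determining the barrier parameter `H`. -/
theorem at1p_psi_strictAntiOn (β s : ℝ) (hs : 0 < s) :
    StrictAntiOn (fun H : ℝ =>
        stdNormalCDF ((-Real.log H + β * s) / Real.sqrt s)
          - H ^ (2 * β) * stdNormalCDF ((Real.log H + β * s) / Real.sqrt s))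
      (Set.Ioo (0:ℝ) 1) := by
  have hr : 0 < √s := Real.sqrt_pos.2 hs
  have hd : ∀ H ∈ Set.Ioo (0:ℝ) 1, HasDerivAt (fun H : ℝ =>
        stdNormalCDF ((-Real.log H + β * s) / Real.sqrt s)
          - H ^ (2 * β) * stdNormalCDF ((Real.log H + β * s) / Real.sqrt s))
      (-(2 * H ^ (2 * β) / H * (gaussianPDFReal 0 1 ((Real.log H + β * s) / √s) / √s
      + β * stdNormalCDF ((Real.log H + β * s) / √s)))) H := by
    rintro H ⟨h0, h1⟩
    have hl := Real.hasDerivAt_log h0.ne'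
    have ha := (aux_cdf_hasDerivAt ((-Real.log H + β * s) / √s)).comp H
      ((hl.neg.add_const (β * s)).div_const (√s))
    have hb := (aux_cdf_hasDerivAt ((Real.log H + β * s) / √s)).comp H
      ((hl.add_const (β * s)).div_const (√s))
    have hp := Real.hasDerivAt_rpow_const (x := H) (p := 2 * β) (Or.inl h0.ne')
    refine HasDerivAt.congr_deriv (ha.sub (hp.mul hb)) ?_
    rw [aux_sym β s H hs h0, Real.rpow_sub_one h0.ne']
    try simp only [Function.comp]
    field_simp
    ring
  refine strictAntiOn_of_deriv_neg (convex_Ioo 0 1)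
    (fun H hH => (hd H hH).continuousAt.continuousWithinAt) fun H hH => ?_
  rw [interior_Ioo] at hH
  rw [(hd H hH).deriv]
  have := aux_key β s H hs hH.1 hH.2
  have h2 := Real.rpow_pos_of_pos hH.1 (2 * β)
  have h0 := hH.1
  rw [neg_lt_zero]
  positivity
end
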